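/- Let d be the metric on ℕ → ℝ given by d(x, y) = sup_n min(|x n − y n|, 1) / 2^(n+1) and d_H the induced Hausdorff metric on nonempty compact subsets. Let A, A₁, …, A_n be nonempty compact max-plus convex subsets of ℕ → ℝ, let r > 0 satisfy d_H(A_i, A) < r for every i = 1, …, n, and let α₁, …, α_n be real numbers with α_i ≤ 0 for all i and max_i α_i = 0. Then d_H(⊕_{i=1}^n α_i ⊙ A_i, A) < r, where ⊕_{i=1}^n α_i ⊙ A_i = { fun m => max_{1 ≤ i ≤ n} (α_i + a_i m) | a_1 ∈ A_1, …, a_n ∈ A_n }. -/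

import Mathlib

/-- Max-plus convexity. -/
def MaxPlusConvex {ι : Type*} (A : Set (ι → ℝ)) : Prop :=
  ∀ a ∈ A, ∀ b ∈ A, ∀ t : ℝ, t ≤ 0 → (fun i => max (a i) (t + b i)) ∈ A

/-- The metric `d(x, y) = sup_n min (|x n - y n|) 1 / 2 ^ (n + 1)` on `ℕ → ℝ`. -/
noncomputable def dd (x y : ℕ → ℝ) : ℝ :=
  ⨆ n : ℕ, (min |x n - y n| 1) / 2 ^ (n + 1)

/-- The Hausdorff distance induced by `dd` on (nonempty compact) subsets of `ℕ → ℝ`. -/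
noncomputable def ddH (A B : Set (ℕ → ℝ)) : ℝ :=
  max (⨆ a : A, ⨅ b : B, dd a b) (⨆ b : B, ⨅ a : A, dd a b)

theorem dd_term_le_one (x y : ℕ → ℝ) (n : ℕ) : (min |x n - y n| 1) / 2 ^ (n + 1) ≤ 1 :=
  div_le_one_of_le₀ ((min_le_right _ _).trans (one_le_pow₀ one_le_two)) (by positivity)

theorem bddAbove_range_dd (x y : ℕ → ℝ) :
    BddAbove (Set.range fun n : ℕ => (min |x n - y n| 1) / 2 ^ (n + 1)) :=
  ⟨1, Set.forall_mem_range.2 (dd_term_le_one x y)⟩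

theorem dd_nonneg (x y : ℕ → ℝ) : 0 ≤ dd x y :=
  Real.iSup_nonneg fun _ => by positivity

theorem dd_le_one (x y : ℕ → ℝ) : dd x y ≤ 1 :=
  ciSup_le (dd_term_le_one x y)

theorem exists_lt_of_iSup_iInf_lt {X Y : Type*} [Nonempty Y] {f : X → Y → ℝ}
    (h0 : ∀ x y, 0 ≤ f x y) (h1 : ∀ x y, f x y ≤ 1) {s : ℝ}
    (h : (⨆ x, ⨅ y, f x y) < s) (x : X) : ∃ y, f x y < s := by
  have hbdd : BddAbove (Set.range fun x => ⨅ y, f x y) :=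
    ⟨1, Set.forall_mem_range.2 fun x =>
      (ciInf_le ⟨0, Set.forall_mem_range.2 (h0 x)⟩ (Classical.arbitrary Y)).trans (h1 _ _)⟩
  exact exists_lt_of_ciInf_lt ((le_ciSup hbdd x).trans_lt h)

theorem iSup_iInf_le_of_exists_le {X Y : Type*} {f : X → Y → ℝ}
    (h0 : ∀ x y, 0 ≤ f x y) {s : ℝ} (hs : 0 ≤ s) (h : ∀ x, ∃ y, f x y ≤ s) :
    (⨆ x, ⨅ y, f x y) ≤ s := by
  refine Real.iSup_le (fun x => ?_) hs
  obtain ⟨y, hy⟩ := h x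
  exact (ciInf_le ⟨0, Set.forall_mem_range.2 (h0 x)⟩ y).trans hy

theorem exists_dd_lt_of_ddH_lt {A B : Set (ℕ → ℝ)} (hA : A.Nonempty) (hB : B.Nonempty) {s : ℝ}
    (h : ddH A B < s) :
    (∀ a ∈ A, ∃ b ∈ B, dd a b < s) ∧ (∀ b ∈ B, ∃ a ∈ A, dd a b < s) := by
  have := hA.to_subtype
  have := hB.to_subtype
  obtain ⟨hl, hr⟩ := max_lt_iff.1 h
  constructor
  · intro a ha
    obtain ⟨b, hb⟩ := exists_lt_of_iSup_iInf_lt (f := fun (a : A) (b : B) => dd a b)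
      (fun _ _ => dd_nonneg _ _) (fun _ _ => dd_le_one _ _) hl ⟨a, ha⟩
    exact ⟨b, b.2, hb⟩
  · intro b hb
    obtain ⟨a, ha⟩ := exists_lt_of_iSup_iInf_lt (f := fun (b : B) (a : A) => dd a b)
      (fun _ _ => dd_nonneg _ _) (fun _ _ => dd_le_one _ _) hr ⟨b, hb⟩
    exact ⟨a, a.2, ha⟩

theorem ddH_le_of_exists_dd_le {A B : Set (ℕ → ℝ)} {s : ℝ} (hs : 0 ≤ s)
    (hl : ∀ a ∈ A, ∃ b ∈ B, dd a b ≤ s) (hr : ∀ b ∈ B, ∃ a ∈ A, dd a b ≤ s) :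
    ddH A B ≤ s := by
  refine max_le (iSup_iInf_le_of_exists_le (fun _ _ => dd_nonneg _ _) hs ?_)
    (iSup_iInf_le_of_exists_le (fun _ _ => dd_nonneg _ _) hs ?_)
  · rintro ⟨a, ha⟩
    obtain ⟨b, hb, h⟩ := hl a ha
    exact ⟨⟨b, hb⟩, h⟩
  · rintro ⟨b, hb⟩
    obtain ⟨a, ha, h⟩ := hr b hb
    exact ⟨⟨a, ha⟩, h⟩

theorem exists_abs_iSup_sub_iSup_le {ι : Type*} [Finite ι] [Nonempty ι] (f g : ι → ℝ) :
    ∃ i, |(⨆ i, f i) - ⨆ i, g i| ≤ |f i - g i| := by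
  obtain ⟨i, hi⟩ := exists_eq_ciSup_of_finite (f := f)
  obtain ⟨j, hj⟩ := exists_eq_ciSup_of_finite (f := g)
  have hf := le_ciSup (Set.finite_range f).bddAbove j
  have hg := le_ciSup (Set.finite_range g).bddAbove i
  rcases le_total (⨆ i, f i) (⨆ i, g i) with h | h
  · refine ⟨j, ?_⟩
    rw [abs_of_nonpos (by linarith)]
    exact le_trans (by linarith) (neg_le_abs _)
  · refine ⟨i, ?_⟩
    rw [abs_of_nonneg (by linarith)]
    exact le_trans (by linarith) (le_abs_self _)

/-- Max-plus combinations are nonexpansive for `dd`. -/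
theorem dd_iSup_add_le {ι : Type*} [Finite ι] [Nonempty ι] (α : ι → ℝ) {a b : ι → ℕ → ℝ} {s : ℝ}
    (h : ∀ i, dd (a i) (b i) ≤ s) :
    dd (fun m => ⨆ i, (α i + a i m)) (fun m => ⨆ i, (α i + b i m)) ≤ s := by
  refine ciSup_le fun m => ?_
  obtain ⟨i, hi⟩ := exists_abs_iSup_sub_iSup_le (fun i => α i + a i m) (fun i => α i + b i m)
  rw [add_sub_add_left_eq_sub] at hi
  refine le_trans ?_ ((le_ciSup (bddAbove_range_dd (a i) (b i)) m).trans (h i))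
  gcongr

/-- A max-plus convex set is closed under finite max-plus convex combinations. -/
theorem MaxPlusConvex.iSup_add_mem {ι κ : Type*} [Finite ι] {A : Set (κ → ℝ)}
    (hA : MaxPlusConvex A) {α : ι → ℝ} (hα : ∀ i, α i ≤ 0) {i₀ : ι} (hi₀ : α i₀ = 0)
    {b : ι → κ → ℝ} (hb : ∀ i, b i ∈ A) : (fun m => ⨆ i, (α i + b i m)) ∈ A := by
  classical
  have := Fintype.ofFinite ι
  have : Nonempty ι := ⟨i₀⟩
  have key (S : Finset ι) : ∃ y ∈ A, ∀ m c, y m ≤ c ↔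
      b i₀ m ≤ c ∧ ∀ i ∈ S, α i + b i m ≤ c := by
    induction S using Finset.induction_on with
    | empty => exact ⟨b i₀, hb i₀, by simp⟩
    | insert j S _ ih =>
      obtain ⟨y, hy, h⟩ := ih
      refine ⟨_, hA y hy (b j) (hb j) (α j) (hα j), fun m c => ?_⟩
      rw [max_le_iff, h, Finset.forall_mem_insert]
      tauto
  obtain ⟨y, hy, h⟩ := key Finset.univ
  convert hy using 1
  funext m
  refine eq_of_forall_ge_iff fun c => ?_
  rw [h, ciSup_le_iff (Set.finite_range _).bddAbove]
  refine ⟨fun hc => ⟨?_, fun i _ => hc i⟩, fun hc i => hc.2 i (Finset.mem_univ i)⟩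
  simpa [hi₀] using hc i₀

/-- If `A₁, …, A_n` are nonempty compact max-plus convex subsets of `ℕ → ℝ` with
`d_H(A_i, A) < r` for all `i`, and `α₁, …, α_n ≤ 0` with `max_i α_i = 0`, then
`d_H(⊕_i α_i ⊙ A_i, A) < r`, where
`⊕_i α_i ⊙ A_i = { fun m => max_i (α_i + a_i m) | a_i ∈ A_i }`. -/
theorem ddH_maxPlusCombination_lt (n : ℕ) (A : Set (ℕ → ℝ))
    (As : Fin (n + 1) → Set (ℕ → ℝ))
    (hA : A.Nonempty ∧ IsCompact A ∧ MaxPlusConvex A)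
    (hAs : ∀ i, (As i).Nonempty ∧ IsCompact (As i) ∧ MaxPlusConvex (As i))
    (r : ℝ) (hr : 0 < r) (hd : ∀ i, ddH (As i) A < r)
    (α : Fin (n + 1) → ℝ) (hα : ∀ i, α i ≤ 0) (hmax : (⨆ i, α i) = 0) :
    ddH {x | ∃ a : Fin (n + 1) → ℕ → ℝ, (∀ i, a i ∈ As i) ∧
      x = fun m => ⨆ i, (α i + a i m)} A < r := by
  obtain ⟨j, hj⟩ := exists_eq_ciSup_of_finite (f := fun i => ddH (As i) A)
  obtain ⟨s, hs, hsr⟩ := exists_between (max_lt hr (hj ▸ hd j : (⨆ i, ddH (As i) A) < r))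
  obtain ⟨hs0, hs⟩ := max_lt_iff.1 hs
  have hds (i) := exists_dd_lt_of_ddH_lt (hAs i).1 hA.1
    ((le_ciSup (Set.finite_range fun i => ddH (As i) A).bddAbove i).trans_lt hs)
  obtain ⟨i₀, hi₀⟩ := exists_eq_ciSup_of_finite (f := α)
  refine (ddH_le_of_exists_dd_le hs0.le ?_ ?_).trans_lt hsr
  · rintro _ ⟨a, ha, rfl⟩
    choose b hb hab using fun i => (hds i).1 (a i) (ha i)
    exact ⟨_, hA.2.2.iSup_add_mem hα (hi₀.trans hmax) hb, dd_iSup_add_le α fun i => (hab i).le⟩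
  · intro b hb
    choose a ha hab using fun i => (hds i).2 b hb
    refine ⟨_, ⟨a, ha, rfl⟩, ?_⟩
    have h := dd_iSup_add_le α (b := fun _ => b) fun i => (hab i).le
    simpa only [← ciSup_add (Set.finite_range α).bddAbove, hmax, zero_add] using h
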